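/- arXiv:2206.03742 — 3 statements merged into one kernel-verified Lean document; each statement's English description precedes it below -/
import Mathlib

section
/- Fix constants 0 < m < M and an integer d ≥ 1. On the domain of (μ, g, h) ∈ (0,∞)^d × ℝ^d × ℝ^d with g_i > h_i ≥ 0 and m ≤ μ_i/(g_i − h_i) ≤ M for all i, define G(μ, g, h) = ∏_{i=1}^d ( (μ_i/(g_i − h_i))^{g_i − h_i} · exp[(1 − log M)·g_i + (log m − 1)·h_i] ), and write ρ_i = μ_i/(g_i − h_i). Then: (1) ∂G/∂μ_i = ((g_i − h_i)/μ_i)·G; (2) if in addition ∑_{i=1}^d (g_i − h_i) = 1, then ∑_{i=1}^d μ_i · ∂G/∂μ_i = G (G is balanced); (3) ∂G/∂g_i = log(ρ_i/M)·G ≤ 0; and (4) ∂G/∂h_i = log(m/ρ_i)·G ≤ 0. -/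
open Real Finset

theorem prod_aux {d : ℕ} (i : Fin d) (F : Fin d → ℝ → ℝ) (f : ℝ → ℝ) (c x P : ℝ)
    (hF : ∀ j, j ≠ i → ∀ t, F j t = F j x) (hf : ∀ t, F i t = f t)
    (hP : P = ∏ j, F j x)
    (hd : HasDerivAt f (c * f x) x) :
    HasDerivAt (fun t => ∏ j, F j t) (c * P) x := by
  have e : ∀ t, ∏ j, F j t = f t * ∏ j ∈ Finset.univ.erase i, F j x := by
    intro t
    rw [← Finset.mul_prod_erase Finset.univ (fun j => F j t) (Finset.mem_univ i), hf]
    congr 1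
    exact Finset.prod_congr rfl (fun j hj => hF j (Finset.ne_of_mem_erase hj) t)
  rw [hP, e x, funext e, ← mul_assoc]
  exact hd.mul_const _


/-- The modified book value generating function has the stated partial derivatives:
it is balanced in `μ` (when `∑ (g_i - h_i) = 1`), and its partial derivatives in
`g_i` and `h_i` are nonpositive. -/
theorem stmt6 (d : ℕ) (hd : 1 ≤ d) (m M : ℝ) (hm : 0 < m) (hmM : m < M)
    (μ g h : Fin d → ℝ)
    (hμ : ∀ i, 0 < μ i) (hh : ∀ i, 0 ≤ h i) (hgh : ∀ i, h i < g i)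
    (ρ : Fin d → ℝ) (hρ : ∀ i, ρ i = μ i / (g i - h i))
    (hρm : ∀ i, m ≤ ρ i) (hρM : ∀ i, ρ i ≤ M)
    (G : (Fin d → ℝ) → (Fin d → ℝ) → (Fin d → ℝ) → ℝ)
    (hG : G = fun μ g h => ∏ i,
      ((μ i / (g i - h i)) ^ (g i - h i) *
        Real.exp ((1 - Real.log M) * g i + (Real.log m - 1) * h i))) :
    (∀ i, HasDerivAt (fun t => G (Function.update μ i t) g h)
        ((g i - h i) / μ i * G μ g h) (μ i)) ∧
    ((∑ i, (g i - h i)) = 1 →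
      ∑ i, μ i * ((g i - h i) / μ i * G μ g h) = G μ g h) ∧
    (∀ i, HasDerivAt (fun t => G μ (Function.update g i t) h)
        (Real.log (ρ i / M) * G μ g h) (g i) ∧
      Real.log (ρ i / M) * G μ g h ≤ 0) ∧
    (∀ i, HasDerivAt (fun t => G μ g (Function.update h i t))
        (Real.log (m / ρ i) * G μ g h) (h i) ∧
      Real.log (m / ρ i) * G μ g h ≤ 0) := by
  have hM : 0 < M := hm.trans hmM
  have hb : ∀ i, 0 < g i - h i := fun i => sub_pos.2 (hgh i)
  have hρ0 : ∀ i, 0 < ρ i := fun i => hm.trans_le (hρm i)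
  have hG0 : 0 ≤ G μ g h := by
    rw [hG]
    refine Finset.prod_nonneg fun i _ => ?_
    have := hb i
    have := hμ i
    positivity
  refine ⟨fun i => ?_, fun hs => ?_, fun i => ⟨?_, ?_⟩, fun i => ⟨?_, ?_⟩⟩
  · subst hG
    have hbi := hb i
    have hμi := hμ i
    have hr : 0 < μ i / (g i - h i) := by positivity
    refine prod_aux i _ (fun t => (t / (g i - h i)) ^ (g i - h i) *
        Real.exp ((1 - Real.log M) * g i + (Real.log m - 1) * h i)) _ _ _ ?_ ?_ ?_ ?_
    · intro j hj t
      simp [Function.update_of_ne hj]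
    · intro t
      simp
    · simp
    · have h1 := ((((hasDerivAt_id (μ i)).div_const (g i - h i)).rpow
        (hasDerivAt_const (μ i) (g i - h i)) hr).mul_const
        (Real.exp ((1 - Real.log M) * g i + (Real.log m - 1) * h i)))
      refine h1.congr_deriv ?_
      simp only [id]
      rw [Real.rpow_sub_one hr.ne']
      field_simp
      ring
  · have : ∀ i ∈ Finset.univ, μ i * ((g i - h i) / μ i * G μ g h) = (g i - h i) * G μ g h := by
      intro i _
      have := (hμ i).ne'
      field_simp
    rw [Finset.sum_congr rfl this, ← Finset.sum_mul, hs, one_mul]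
  · subst hG
    have hbi := hb i
    have hμi := hμ i
    have hr : 0 < μ i / (g i - h i) := by positivity
    refine prod_aux i _ (fun t => (μ i / (t - h i)) ^ (t - h i) *
        Real.exp ((1 - Real.log M) * t + (Real.log m - 1) * h i)) _ _ _ ?_ ?_ ?_ ?_
    · intro j hj t
      simp [Function.update_of_ne hj]
    · intro t
      simp
    · simp
    · have hb1 := (hasDerivAt_id (g i)).sub_const (h i)
      have h1 := (((hasDerivAt_const (g i) (μ i)).div hb1 hbi.ne').rpow hb1 hr).mul
        ((((hasDerivAt_id (g i)).const_mul (1 - Real.log M)).add_const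
          ((Real.log m - 1) * h i)).exp)
      refine h1.congr_deriv ?_
      simp only [id, Pi.div_apply]
      rw [Real.rpow_sub_one hr.ne', Real.log_div (hρ0 i).ne' hM.ne', hρ i]
      generalize Real.log (μ i / (g i - h i)) = L
      generalize (μ i / (g i - h i)) ^ (g i - h i) = R
      field_simp
      ring
  · refine mul_nonpos_of_nonpos_of_nonneg (Real.log_nonpos ?_ ?_) hG0
    · exact (div_pos (hρ0 i) hM).le
    · exact (div_le_one hM).2 (hρM i)
  · subst hG
    have hbi := hb i
    have hμi := hμ i
    have hr : 0 < μ i / (g i - h i) := by positivity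
    refine prod_aux i _ (fun t => (μ i / (g i - t)) ^ (g i - t) *
        Real.exp ((1 - Real.log M) * g i + (Real.log m - 1) * t)) _ _ _ ?_ ?_ ?_ ?_
    · intro j hj t
      simp [Function.update_of_ne hj]
    · intro t
      simp
    · simp
    · have hb1 := (hasDerivAt_id (h i)).const_sub (g i)
      have h1 := (((hasDerivAt_const (h i) (μ i)).div hb1 hbi.ne').rpow hb1 hr).mul
        ((((hasDerivAt_id (h i)).const_mul (Real.log m - 1)).const_add
          ((1 - Real.log M) * g i)).exp)
      refine h1.congr_deriv ?_
      simp only [id, Pi.div_apply]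
      rw [Real.rpow_sub_one hr.ne', Real.log_div hm.ne' (hρ0 i).ne', hρ i]
      generalize Real.log (μ i / (g i - h i)) = L
      generalize (μ i / (g i - h i)) ^ (g i - h i) = R
      field_simp
      ring
  · refine mul_nonpos_of_nonpos_of_nonneg (Real.log_nonpos ?_ ?_) hG0
    · exact (div_pos hm (hρ0 i)).le
    · exact (div_le_one (hρ0 i)).2 (hρm i)
end

section
/- Fix δ > 0, an integer d ≥ 1, and a real p ≠ 0. On the domain of (μ, g, h) ∈ (0,∞)^d × ℝ^d × ℝ^d with g_i > h_i ≥ 0 and g_i − h_i ≥ δ for all i, set β_i = g_i − h_i, a_i = (μ_i g_i / β_i)·e^{−h_i/δ}, and G(μ, g, h) = (∑_{i=1}^d a_i^p)^{1/p}. Then for every i: ∂G/∂g_i = −G · (h_i/(β_i g_i)) · a_i^p/(∑_{j=1}^d a_j^p) ≤ 0, and ∂G/∂h_i = −G · (1/δ − 1/β_i) · a_i^p/(∑_{j=1}^d a_j^p) ≤ 0. -/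
open Real Finset

theorem aux_deriv {d : ℕ} (p : ℝ) (hp : p ≠ 0) (i : Fin d) (F : ℝ → Fin d → ℝ) (a : Fin d → ℝ)
    (t c : ℝ) (hF : ∀ j, F t j = a j) (ha : ∀ j, 0 < a j)
    (hi : HasDerivAt (fun s => F s i) (a i * c) t)
    (hj : ∀ j, j ≠ i → ∀ s, F s j = a j) :
    HasDerivAt (fun s => (∑ j, F s j ^ p) ^ (1 / p))
      ((∑ j, a j ^ p) ^ (1 / p) * c * (a i ^ p / ∑ j, a j ^ p)) t := by
  have hS : 0 < ∑ j, a j ^ p :=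
    Finset.sum_pos (fun j _ => Real.rpow_pos_of_pos (ha j) p) ⟨i, Finset.mem_univ i⟩
  have h1 : ∀ j ∈ (Finset.univ : Finset (Fin d)),
      HasDerivAt (fun s => F s j ^ p) (if j = i then p * c * a i ^ p else 0) t := by
    intro j _
    by_cases hji : j = i
    · subst hji
      have := hi.rpow_const (p := p) (Or.inl (by rw [hF]; exact (ha j).ne'))
      rw [hF] at this
      simp only [if_true]
      convert this using 1
      rw [Real.rpow_sub_one (ha j).ne']
      have := (ha j).ne'
      field_simp
    · simp only [hji, if_false, hj j hji]
      exact hasDerivAt_const _ _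
  have h2 := HasDerivAt.fun_sum h1
  simp only [Finset.sum_ite_eq', Finset.mem_univ, if_true] at h2
  have hSt : ∑ j, F t j ^ p = ∑ j, a j ^ p := by simp only [hF]
  have h3 := h2.rpow_const (p := 1 / p) (Or.inl (by rw [hSt]; exact hS.ne'))
  rw [hSt] at h3
  convert h3 using 1
  rw [Real.rpow_sub_one hS.ne']
  have := hS.ne'
  field_simp

/-- For the modified market-to-book ratio weighted generating function
`G = (∑ a_i^p)^{1/p}` with `a_i = (μ_i g_i / β_i) e^{-h_i/δ}`, the partial
derivatives in `g_i` and `h_i` are as stated and nonpositive. -/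
theorem stmt9 (d : ℕ) (hd : 1 ≤ d) (δ : ℝ) (hδ : 0 < δ) (p : ℝ) (hp : p ≠ 0)
    (μ g h : Fin d → ℝ) (hμ : ∀ i, 0 < μ i) (hh : ∀ i, 0 ≤ h i)
    (hgh : ∀ i, h i < g i) (hδβ : ∀ i, δ ≤ g i - h i)
    (β a : Fin d → ℝ)
    (hβ : ∀ i, β i = g i - h i)
    (ha : ∀ i, a i = μ i * g i / β i * Real.exp (-(h i) / δ))
    (G : (Fin d → ℝ) → (Fin d → ℝ) → (Fin d → ℝ) → ℝ)
    (hG : G = fun μ g h =>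
      (∑ i, (μ i * g i / (g i - h i) * Real.exp (-(h i) / δ)) ^ p) ^ (1 / p)) :
    ∀ i,
      (HasDerivAt (fun t => G μ (Function.update g i t) h)
          (-(G μ g h) * (h i / (β i * g i)) * (a i ^ p / ∑ j, a j ^ p)) (g i) ∧
        -(G μ g h) * (h i / (β i * g i)) * (a i ^ p / ∑ j, a j ^ p) ≤ 0) ∧
      (HasDerivAt (fun t => G μ g (Function.update h i t))
          (-(G μ g h) * (1 / δ - 1 / β i) * (a i ^ p / ∑ j, a j ^ p)) (h i) ∧
        -(G μ g h) * (1 / δ - 1 / β i) * (a i ^ p / ∑ j, a j ^ p) ≤ 0) := by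
  intro i
  have hβp : ∀ j, 0 < β j := fun j => by rw [hβ]; linarith [hgh j]
  have hgp : ∀ j, 0 < g j := fun j => lt_of_le_of_lt (hh j) (hgh j)
  have hap : ∀ j, 0 < a j := fun j => by
    rw [ha]
    have := hμ j
    have := hβp j
    have := hgp j
    positivity
  have hae : ∀ j, μ j * g j / (g j - h j) * Real.exp (-(h j) / δ) = a j := fun j => by
    rw [ha, hβ]
  have hGe : G μ g h = (∑ j, a j ^ p) ^ (1 / p) := by
    rw [hG]
    simp only [hae]
  have hS : 0 < ∑ j, a j ^ p :=
    Finset.sum_pos (fun j _ => Real.rpow_pos_of_pos (hap j) p) ⟨i, Finset.mem_univ i⟩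
  have hGp : 0 < G μ g h := by rw [hGe]; exact Real.rpow_pos_of_pos hS _
  have hw : 0 < a i ^ p / ∑ j, a j ^ p := div_pos (Real.rpow_pos_of_pos (hap i) p) hS
  have hb := hβp i
  have hg := hgp i
  have hne : g i - h i ≠ 0 := by rw [← hβ]; exact hb.ne'
  refine ⟨⟨?_, ?_⟩, ?_, ?_⟩
  · have key := aux_deriv p hp i (fun t j => μ j * Function.update g i t j /
      (Function.update g i t j - h j) * Real.exp (-(h j) / δ)) a (g i) (-(h i / (β i * g i)))
      (fun j => by simp only [Function.update_eq_self, hae]) hap ?_ ?_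
    · rw [hGe, hG]
      convert key using 1
      ring
    · simp only [Function.update_self]
      have h1 := ((((hasDerivAt_id (g i)).const_mul (μ i)).div
        ((hasDerivAt_id (g i)).sub_const (h i)) hne).mul_const (Real.exp (-(h i) / δ)))
      refine HasDerivAt.congr_deriv h1 ?_
      rw [ha, hβ]
      simp only [id]
      have := hg.ne'
      field_simp
      ring
    · intro j hj s
      simp only [Function.update_of_ne hj, hae]
  · have : 0 ≤ h i / (β i * g i) := div_nonneg (hh i) (by positivity)
    have := mul_nonneg (mul_nonneg hGp.le this) hw.le
    linarith
  · have key := aux_deriv p hp i (fun t j => μ j * g j /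
      (g j - Function.update h i t j) * Real.exp (-(Function.update h i t j) / δ)) a (h i)
      (-(1 / δ - 1 / β i))
      (fun j => by simp only [Function.update_eq_self, hae]) hap ?_ ?_
    · rw [hGe, hG]
      convert key using 1
      ring
    · simp only [Function.update_self]
      have h1 := (((hasDerivAt_const (h i) (μ i * g i)).div
        ((hasDerivAt_id (h i)).const_sub (g i)) hne).mul
        (((hasDerivAt_id (h i)).neg.div_const δ).exp))
      refine HasDerivAt.congr_deriv h1 ?_
      rw [ha, hβ]
      simp only [id, Pi.neg_apply, Pi.div_apply]
      field_simp
      ring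
    · intro j hj s
      simp only [Function.update_of_ne hj, hae]
  · have : 0 ≤ 1 / δ - 1 / β i :=
      sub_nonneg.2 (one_div_le_one_div_of_le hδ (by rw [hβ]; exact hδβ i))
    have := mul_nonneg (mul_nonneg hGp.le this) hw.le
    linarith
end

section
/- Fix constants m > 0 and δ > 0, set κ = ((1+m)/m)·log(1+m), and let d ≥ 1. On the domain of (μ, g, h) ∈ (0,∞)^d × ℝ^d × ℝ^d with g_i > h_i ≥ 0, β_i := g_i − h_i ≥ δ, and ρ_i := μ_i/β_i ≥ m for all i, define G(μ, g, h) = ∑_{i=1}^d log(1 + μ_i/(g_i − h_i)) · exp(−h_i/(δκ)). Then for every i: (1) ∂G/∂g_i = −(ρ_i/(β_i + μ_i))·exp(−h_i/(δκ)) ≤ 0; and (2) ∂G/∂h_i = ( ρ_i/(β_i + μ_i) − log(1 + ρ_i)/(δκ) )·exp(−h_i/(δκ)) ≤ 0; in particular, log(1 + ρ_i)/(δκ) ≥ ρ_i/(β_i(1 + ρ_i)) = ρ_i/(β_i + μ_i). -/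
open Real Finset

lemma aux_mono (m r : ℝ) (hm : 0 < m) (hr : m ≤ r) :
    (1 + m) / m * Real.log (1 + m) ≤ (1 + r) / r * Real.log (1 + r) := by
  have h := Real.convexOn_mul_log.secant_mono (a := 1) (x := 1 + m) (y := 1 + r)
    (by simp) (by simp; linarith) (by simp; linarith) (by linarith) (by linarith) (by linarith)
  simp only [Real.log_one, mul_zero, sub_zero, add_sub_cancel_left] at h
  rw [div_mul_eq_mul_div, div_mul_eq_mul_div]
  exact h

lemma aux_sum (d : ℕ) (F : Fin d → ℝ → ℝ) (x : Fin d → ℝ) (i : Fin d) (D : ℝ)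
    (hD : HasDerivAt (F i) D (x i)) :
    HasDerivAt (fun t => ∑ j, F j (Function.update x i t j)) D (x i) := by
  have := HasDerivAt.fun_sum (u := (Finset.univ : Finset (Fin d)))
    (A := fun j t => F j (Function.update x i t j))
    (A' := fun j => if j = i then D else 0) (x := x i) (by
      intro j _
      by_cases hj : j = i
      · subst hj; simpa using hD
      · simpa [hj] using hasDerivAt_const (x i) (F j (x j)))
  simpa using this



/-- The logarithmic generating function
`G(μ,g,h) = ∑ log(1 + μ_i/(g_i-h_i)) exp(-h_i/(δκ))` has nonpositive partial
derivatives in `g_i` and `h_i`, with the stated formulas. -/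
theorem stmt12 (d : ℕ) (hd : 1 ≤ d) (m δ : ℝ) (hm : 0 < m) (hδ : 0 < δ)
    (κ : ℝ) (hκ : κ = (1 + m) / m * Real.log (1 + m))
    (μ g h : Fin d → ℝ) (hμ : ∀ i, 0 < μ i) (hh : ∀ i, 0 ≤ h i)
    (hgh : ∀ i, h i < g i)
    (β ρ : Fin d → ℝ)
    (hβ : ∀ i, β i = g i - h i) (hρ : ∀ i, ρ i = μ i / β i)
    (hβδ : ∀ i, δ ≤ β i) (hρm : ∀ i, m ≤ ρ i)
    (G : (Fin d → ℝ) → (Fin d → ℝ) → (Fin d → ℝ) → ℝ)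
    (hG : G = fun μ g h =>
      ∑ i, Real.log (1 + μ i / (g i - h i)) * Real.exp (-(h i) / (δ * κ))) :
    ∀ i,
      (HasDerivAt (fun t => G μ (Function.update g i t) h)
          (-(ρ i / (β i + μ i)) * Real.exp (-(h i) / (δ * κ))) (g i) ∧
        -(ρ i / (β i + μ i)) * Real.exp (-(h i) / (δ * κ)) ≤ 0) ∧
      (HasDerivAt (fun t => G μ g (Function.update h i t))
          ((ρ i / (β i + μ i) - Real.log (1 + ρ i) / (δ * κ))
            * Real.exp (-(h i) / (δ * κ))) (h i) ∧
        (ρ i / (β i + μ i) - Real.log (1 + ρ i) / (δ * κ))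
          * Real.exp (-(h i) / (δ * κ)) ≤ 0) ∧
      (Real.log (1 + ρ i) / (δ * κ) ≥ ρ i / (β i * (1 + ρ i)) ∧
        ρ i / (β i * (1 + ρ i)) = ρ i / (β i + μ i)) := by

  intro i
  have hb : 0 < β i := lt_of_lt_of_le hδ (hβδ i)
  have hr : 0 < ρ i := lt_of_lt_of_le hm (hρm i)
  have hmu := hμ i
  have hμe : μ i = ρ i * β i := by rw [hρ i]; field_simp
  have hk : 0 < κ := by
    rw [hκ]
    have := Real.log_pos (show 1 < 1 + m by linarith)
    positivity
  have e1 : ρ i / (β i * (1 + ρ i)) = ρ i / (β i + μ i) := by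
    rw [hμe]; ring_nf
  have e2 : Real.log (1 + ρ i) / (δ * κ) ≥ ρ i / (β i * (1 + ρ i)) := by
    have h1 := aux_mono m (ρ i) hm (hρm i)
    rw [← hκ] at h1
    have hl : κ * ρ i ≤ (1 + ρ i) * Real.log (1 + ρ i) := by
      rw [div_mul_eq_mul_div, le_div_iff₀ hr] at h1
      exact h1
    rw [ge_iff_le, div_le_div_iff₀ (by positivity) (by positivity)]
    calc ρ i * (δ * κ) = δ * (κ * ρ i) := by ring
      _ ≤ β i * ((1 + ρ i) * Real.log (1 + ρ i)) :=
        mul_le_mul (hβδ i) hl (by positivity) hb.le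
      _ = _ := by ring
  have hne : g i - h i ≠ 0 := by rw [← hβ i]; exact hb.ne'
  have hq : μ i / (g i - h i) = ρ i := by rw [hρ i, hβ i]
  have hne2 : 1 + μ i / (g i - h i) ≠ 0 := by rw [hq]; positivity
  refine ⟨⟨?_, ?_⟩, ⟨?_, ?_⟩, e2, e1⟩
  · rw [hG]
    refine aux_sum d (fun j t => Real.log (1 + μ j / (t - h j)) *
      Real.exp (-(h j) / (δ * κ))) g i _ ?_
    have := (((((hasDerivAt_id (g i)).sub_const (h i)).fun_inv hne).const_mul (μ i)).const_add 1)
    have h2 := (this.log (by simpa [div_eq_mul_inv] using hne2)).mul_const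
      (Real.exp (-(h i) / (δ * κ)))
    simp only [id, ← div_eq_mul_inv] at h2
    refine h2.congr_deriv ?_
    rw [hq, ← hβ i, hμe]
    field_simp
  · have : 0 < ρ i / (β i + μ i) * Real.exp (-(h i) / (δ * κ)) := by positivity
    linarith
  · rw [hG]
    refine aux_sum d (fun j t => Real.log (1 + μ j / (g j - t)) *
      Real.exp (-t / (δ * κ))) h i _ ?_
    have := (((((hasDerivAt_id (h i)).const_sub (g i)).fun_inv hne).const_mul (μ i)).const_add 1)
    have h2 := (this.log (by simpa [div_eq_mul_inv] using hne2)).fun_mul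
      (((hasDerivAt_id (h i)).fun_neg.div_const (δ * κ)).exp)
    simp only [id, ← div_eq_mul_inv] at h2
    refine h2.congr_deriv ?_
    rw [hq, ← hβ i, hμe]
    field_simp
    ring
  · rw [e1] at e2
    exact mul_nonpos_of_nonpos_of_nonneg (by linarith) (Real.exp_pos _).le
end
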